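/- Geodesics realize the absolute minimum of the length functional: for every smooth curve φ : [0,1] → 𝒞, the geodesic distance between its endpoints is at most its length, i.e. arccos( 4 ∫_M e^{(φ(0)+φ(1))/2} dμ ) ≤ ∫₀¹ ( ∫_M (∂_τ φ(τ))² e^{φ(τ)} dμ )^{1/2} dτ. -/

import Mathlib

open MeasureTheory Real

/-- A smooth family of real functions on `M` parametrized by a normed space `E`. -/
def SmoothFamily {E M : Type*} [NormedAddCommGroup E] [NormedSpace ℝ E] [TopologicalSpace M]
    (f : E → M → ℝ) : Prop :=
  (∀ p, ContDiff ℝ (⊤ : ℕ∞) fun z => f z p) ∧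
    ∀ n : ℕ, Continuous fun q : E × M => iteratedFDeriv ℝ n (fun z => f z q.2) q.1

/-- Cauchy–Schwarz for continuous functions on a compact space. -/
lemma sq_integral_mul_le_of_continuous {M : Type*} [TopologicalSpace M] [CompactSpace M]
    [MeasurableSpace M] [BorelSpace M] (μ : Measure M) [IsFiniteMeasure μ]
    {f g : M → ℝ} (hf : Continuous f) (hg : Continuous g) :
    (∫ p, f p * g p ∂μ) ^ 2 ≤ (∫ p, f p ^ 2 ∂μ) * ∫ p, g p ^ 2 ∂μ := by
  have hint : ∀ {h : M → ℝ}, Continuous h → Integrable h μ := fun hh =>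
    hh.integrable_of_hasCompactSupport (HasCompactSupport.of_compactSpace _)
  have hquad : ∀ x : ℝ, 0 ≤ (∫ p, f p ^ 2 ∂μ) * (x * x) + (2 * ∫ p, f p * g p ∂μ) * x
      + ∫ p, g p ^ 2 ∂μ := by
    intro x
    have hexpand : ∫ p, (x * f p + g p) ^ 2 ∂μ
        = (∫ p, f p ^ 2 ∂μ) * (x * x) + (2 * ∫ p, f p * g p ∂μ) * x + ∫ p, g p ^ 2 ∂μ := by
      have hpt : ∀ p, (x * f p + g p) ^ 2
          = (x * x) * f p ^ 2 + (2 * x) * (f p * g p) + g p ^ 2 := fun p => by ring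
      simp_rw [hpt]
      rw [integral_add (hint (by fun_prop)) (hint (by fun_prop)),
        integral_add (hint (by fun_prop)) (hint (by fun_prop)),
        integral_const_mul, integral_const_mul]
      ring
    rw [← hexpand]
    exact integral_nonneg fun p => sq_nonneg _
  have hdiscrim := discrim_le_zero hquad
  rw [discrim] at hdiscrim
  nlinarith

/-- Differentiation under the integral sign over a compact space. -/
lemma hasDerivAt_integral_of_continuous_deriv {M : Type*} [TopologicalSpace M] [CompactSpace M]
    [MeasurableSpace M] [BorelSpace M] (μ : Measure M) [IsFiniteMeasure μ] {F F' : ℝ → M → ℝ}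
    (hF : Continuous fun q : ℝ × M => F q.1 q.2) (hF' : Continuous fun q : ℝ × M => F' q.1 q.2)
    (hderiv : ∀ τ p, HasDerivAt (fun r => F r p) (F' τ p) τ) (τ : ℝ) :
    HasDerivAt (fun r => ∫ p, F r p ∂μ) (∫ p, F' τ p ∂μ) τ := by
  have hslice : ∀ {G : ℝ → M → ℝ}, (Continuous fun q : ℝ × M => G q.1 q.2) →
      ∀ r, Continuous (G r) := fun hG r =>
    hG.comp (f := fun p => (r, p)) (by fun_prop)
  have hcompact : IsCompact (Metric.closedBall τ 1 ×ˢ (Set.univ : Set M)) :=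
    (isCompact_closedBall τ 1).prod isCompact_univ
  obtain ⟨C, hC⟩ := hcompact.exists_bound_of_continuousOn hF'.continuousOn
  refine (hasDerivAt_integral_of_dominated_loc_of_deriv_le (bound := fun _ => C)
    (Metric.closedBall_mem_nhds τ one_pos) (.of_forall fun r =>
      (hslice hF r).aestronglyMeasurable)
    ((hslice hF τ).integrable_of_hasCompactSupport (HasCompactSupport.of_compactSpace _))
    (hslice hF' τ).aestronglyMeasurable (.of_forall fun p r hr => hC (r, p) ⟨hr, trivial⟩)
    (integrable_const C) (.of_forall fun p r _ => hderiv r p)).2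

/-- A function into `[-1, 1]` whose derivative is at most `L * √(1 - f ^ 2)` in absolute value
moves by an angle of at most `∫ L`. -/
lemma arccos_le_arccos_add_integral {f f' L : ℝ → ℝ} (hL : Continuous L) (hL0 : ∀ t, 0 ≤ L t)
    (hf : ∀ t, HasDerivAt f (f' t) t)
    (hf1 : ∀ t ∈ Set.Icc (0 : ℝ) 1, f t ^ 2 ≤ 1)
    (hf' : ∀ t ∈ Set.Ioo (0 : ℝ) 1, |f' t| ≤ L t * √(1 - f t ^ 2)) :
    arccos (f 1) ≤ arccos (f 0) + ∫ t in (0 : ℝ)..1, L t := by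
  have hcontract : ∀ c ∈ Set.Ioo (0 : ℝ) 1,
      arccos (c * f 1) ≤ arccos (c * f 0) + ∫ t in (0 : ℝ)..1, L t := by
    rintro c ⟨hc0, hc1⟩
    have hc2 : c ^ 2 < 1 := by nlinarith
    have hfc : Continuous f := continuous_iff_continuousAt.2 fun t => (hf t).continuousAt
    have hprim : ∀ t, HasDerivAt (fun x => ∫ s in (0 : ℝ)..x, L s) (L t) t := fun t =>
      intervalIntegral.integral_hasDerivAt_right (hL.intervalIntegrable _ _)
        (hL.stronglyMeasurableAtFilter _ _) hL.continuousAt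
    have hprimc : Continuous fun x => ∫ s in (0 : ℝ)..x, L s :=
      continuous_iff_continuousAt.2 fun t => (hprim t).continuousAt
    have hderiv : ∀ t ∈ Set.Ioo (0 : ℝ) 1,
        HasDerivAt (fun x => arccos (c * f x) - ∫ s in (0 : ℝ)..x, L s)
          (-(1 / √(1 - (c * f t) ^ 2)) * (c * f' t) - L t) t := by
      intro t ht
      have hsq := hf1 t (Set.Ioo_subset_Icc_self ht)
      have hlt : (c * f t) ^ 2 < 1 := by nlinarith [sq_nonneg c, sq_nonneg (f t)]
      have hlt' := abs_lt.1 ((sq_lt_one_iff_abs_lt_one _).1 hlt)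
      exact ((hasDerivAt_arccos hlt'.1.ne' hlt'.2.ne).comp t ((hf t).const_mul c)).sub (hprim t)
    have hanti : AntitoneOn (fun x => arccos (c * f x) - ∫ s in (0 : ℝ)..x, L s)
        (Set.Icc 0 1) := by
      refine antitoneOn_of_deriv_nonpos (convex_Icc 0 1)
        ((continuous_arccos.comp (hfc.const_mul c)).sub hprimc).continuousOn ?_ ?_
      · rw [interior_Icc]
        exact fun t ht => (hderiv t ht).differentiableAt.differentiableWithinAt
      · rw [interior_Icc]
        intro t ht
        rw [(hderiv t ht).deriv]
        have hsq := hf1 t (Set.Ioo_subset_Icc_self ht)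
        have hlt : (c * f t) ^ 2 < 1 := by nlinarith [sq_nonneg c, sq_nonneg (f t)]
        have hpos : 0 < √(1 - (c * f t) ^ 2) := sqrt_pos.2 (by linarith)
        have hmono : √(1 - f t ^ 2) ≤ √(1 - (c * f t) ^ 2) :=
          sqrt_le_sqrt (by nlinarith [sq_nonneg (f t)])
        have hbound : -(c * f' t) ≤ L t * √(1 - (c * f t) ^ 2) := by
          calc -(c * f' t) ≤ c * |f' t| := by nlinarith [neg_abs_le (f' t)]
            _ ≤ |f' t| := mul_le_of_le_one_left (abs_nonneg _) hc1.le
            _ ≤ L t * √(1 - f t ^ 2) := hf' t ht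
            _ ≤ _ := mul_le_mul_of_nonneg_left hmono (hL0 t)
        have hdiv := (div_le_iff₀ hpos).2 hbound
        have hrw : -(1 / √(1 - (c * f t) ^ 2)) * (c * f' t)
          = -(c * f' t) / √(1 - (c * f t) ^ 2) := by ring
        rw [hrw]
        linarith
    have hends := hanti (Set.left_mem_Icc.2 zero_le_one) (Set.right_mem_Icc.2 zero_le_one)
      zero_le_one
    simp only [intervalIntegral.integral_same, sub_zero] at hends
    linarith
  have hlim : ∀ y : ℝ, Filter.Tendsto (fun c : ℝ => arccos (c * y)) (nhdsWithin 1 (Set.Iio 1))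
      (nhds (arccos y)) := by
    intro y
    have hcont : Continuous fun c : ℝ => arccos (c * y) :=
      continuous_arccos.comp (continuous_id.mul continuous_const)
    simpa using (hcont.tendsto 1).mono_left nhdsWithin_le_nhds
  exact le_of_tendsto_of_tendsto (hlim _) ((hlim _).add_const _)
    (Filter.eventually_of_mem (Ioo_mem_nhdsLT one_pos) hcontract)

lemma SmoothFamily.continuous {E M : Type*} [NormedAddCommGroup E] [NormedSpace ℝ E]
    [TopologicalSpace M] {f : E → M → ℝ} (hf : SmoothFamily f) :
    Continuous fun q : E × M => f q.1 q.2 := by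
  have hzero := (ContinuousMultilinearMap.apply ℝ (fun _ : Fin 0 => E) ℝ 0).continuous.comp
    (hf.2 0)
  exact hzero.congr fun q => by simp

lemma SmoothFamily.continuous_deriv {M : Type*} [TopologicalSpace M] {f : ℝ → M → ℝ}
    (hf : SmoothFamily f) : Continuous fun q : ℝ × M => deriv (fun r => f r q.2) q.1 := by
  have hone := (ContinuousMultilinearMap.apply ℝ (fun _ : Fin 1 => ℝ) ℝ
    (fun _ => 1)).continuous.comp (hf.2 1)
  refine hone.congr fun q => ?_
  rw [← iteratedDeriv_one, iteratedDeriv_eq_iteratedFDeriv]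
  rfl

lemma SmoothFamily.hasDerivAt {M : Type*} [TopologicalSpace M] {f : ℝ → M → ℝ}
    (hf : SmoothFamily f) (τ : ℝ) (p : M) :
    HasDerivAt (fun r => f r p) (deriv (fun r => f r p) τ) τ :=
  (((hf.1 p).differentiable (by simp)) τ).hasDerivAt

/-- Geodesics realize the absolute minimum of the length functional:
for every smooth curve `φ : [0,1] → 𝒞`, the geodesic distance between its endpoints is at
most its length. -/
theorem calabi_geodesics_minimize_length
    {M : Type*} [TopologicalSpace M] [CompactSpace M] [Nonempty M]
    [MeasurableSpace M] [BorelSpace M]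
    (μ : Measure M) [IsFiniteMeasure μ] [μ.IsOpenPosMeasure]
    (hVol : (μ Set.univ).toReal = 1 / 4)
    (φ : ℝ → M → ℝ) (hφ : SmoothFamily φ)
    (hφC : ∀ τ ∈ Set.Icc (0 : ℝ) 1, ∫ p, Real.exp (φ τ p) ∂μ = 1 / 4) :
    Real.arccos (4 * ∫ p, Real.exp ((φ 0 p + φ 1 p) / 2) ∂μ)
      ≤ ∫ τ in (0 : ℝ)..1,
          Real.sqrt (∫ p, (deriv (fun r => φ r p) τ) ^ 2 * Real.exp (φ τ p) ∂μ) := by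
  have hint : ∀ {h : M → ℝ}, Continuous h → Integrable h μ := fun hh =>
    hh.integrable_of_hasCompactSupport (HasCompactSupport.of_compactSpace _)
  have hc := hφ.continuous
  have hc' := hφ.continuous_deriv
  have hcτ : ∀ τ, Continuous (φ τ) := fun τ =>
    hc.comp (f := fun p => (τ, p)) (by fun_prop)
  have hcτ' : ∀ τ, Continuous fun p => deriv (fun r => φ r p) τ := fun τ =>
    hc'.comp (f := fun p => (τ, p)) (by fun_prop)
  set L : ℝ → ℝ := fun τ =>
    √(∫ p, (deriv (fun r => φ r p) τ) ^ 2 * Real.exp (φ τ p) ∂μ) with hLdef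
  set f : ℝ → ℝ := fun τ => 4 * ∫ p, Real.exp ((φ 0 p + φ τ p) / 2) ∂μ with hfdef
  set f' : ℝ → ℝ := fun τ => 4 * ∫ p, Real.exp ((φ 0 p + φ τ p) / 2)
    * (deriv (fun r => φ r p) τ / 2) ∂μ with hf'def
  have hc0 : Continuous fun q : ℝ × M => φ 0 q.2 := (hcτ 0).comp continuous_snd
  have hL : Continuous L := by
    refine continuous_sqrt.comp ?_
    have hparam := continuous_parametric_integral_of_continuous (μ := μ) (s := Set.univ)
      (f := fun τ p => (deriv (fun r => φ r p) τ) ^ 2 * Real.exp (φ τ p))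
      (by simp only [Function.uncurry_def]; fun_prop) isCompact_univ
    simpa using hparam
  have hf : ∀ τ, HasDerivAt f (f' τ) τ := fun τ =>
    (hasDerivAt_integral_of_continuous_deriv μ
      (F := fun τ p => Real.exp ((φ 0 p + φ τ p) / 2))
      (F' := fun τ p => Real.exp ((φ 0 p + φ τ p) / 2) * (deriv (fun r => φ r p) τ / 2))
      (continuous_exp.comp ((hc0.add hc).div_const 2))
      ((continuous_exp.comp ((hc0.add hc).div_const 2)).mul (hc'.div_const 2))
      (fun τ p => (((hφ.hasDerivAt τ p).const_add _).div_const 2).exp) τ).const_mul 4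
  have hexp_add : ∀ τ p, Real.exp ((φ 0 p + φ τ p) / 2)
      = Real.exp (φ 0 p / 2) * Real.exp (φ τ p / 2) := fun τ p => by
    rw [← Real.exp_add]; ring_nf
  have hexp_sq : ∀ τ p, Real.exp (φ τ p / 2) ^ 2 = Real.exp (φ τ p) := fun τ p => by
    rw [← Real.exp_nat_mul]; ring_nf
  have hperp : ∀ τ ∈ Set.Icc (0 : ℝ) 1,
      ∫ p, (Real.exp (φ 0 p / 2) - f τ * Real.exp (φ τ p / 2)) ^ 2 ∂μ
        = (1 - f τ ^ 2) / 4 := by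
    intro τ hτ
    have hpt : ∀ p, (Real.exp (φ 0 p / 2) - f τ * Real.exp (φ τ p / 2)) ^ 2
        = Real.exp (φ 0 p) - (2 * f τ) * Real.exp ((φ 0 p + φ τ p) / 2)
          + f τ ^ 2 * Real.exp (φ τ p) := fun p => by
      rw [hexp_add, ← hexp_sq 0, ← hexp_sq τ]; ring
    simp_rw [hpt]
    have h0 := hcτ 0
    have hτ' := hcτ τ
    rw [integral_add (hint (by fun_prop)) (hint (by fun_prop)),
      integral_sub (hint (by fun_prop)) (hint (by fun_prop)),
      integral_const_mul, integral_const_mul, hφC τ hτ, hφC 0 (by simp)]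
    have hfτ : f τ = 4 * ∫ p, Real.exp ((φ 0 p + φ τ p) / 2) ∂μ := rfl
    linear_combination (-f τ / 2) * (-hfτ)
  have hf1 : ∀ τ ∈ Set.Icc (0 : ℝ) 1, f τ ^ 2 ≤ 1 := by
    intro τ hτ
    have hnonneg : 0 ≤ ∫ p, (Real.exp (φ 0 p / 2) - f τ * Real.exp (φ τ p / 2)) ^ 2 ∂μ :=
      integral_nonneg fun p => sq_nonneg _
    rw [hperp τ hτ] at hnonneg
    linarith
  have htangent : ∀ τ ∈ Set.Ioo (0 : ℝ) 1,
      ∫ p, Real.exp (φ τ p) * deriv (fun r => φ r p) τ ∂μ = 0 := by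
    intro τ hτ
    have hvol := hasDerivAt_integral_of_continuous_deriv μ
      (F := fun τ p => Real.exp (φ τ p))
      (F' := fun τ p => Real.exp (φ τ p) * deriv (fun r => φ r p) τ)
      (continuous_exp.comp hc) ((continuous_exp.comp hc).mul hc')
      (fun τ p => (hφ.hasDerivAt τ p).exp) τ
    refine hvol.unique ((hasDerivAt_const τ (1 / 4 : ℝ)).congr_of_eventuallyEq ?_)
    filter_upwards [Icc_mem_nhds hτ.1 hτ.2] with r hr using hφC r hr
  have hf' : ∀ τ ∈ Set.Ioo (0 : ℝ) 1, |f' τ| ≤ L τ * √(1 - f τ ^ 2) := by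
    intro τ hτ
    have h0 := hcτ 0
    have hτc := hcτ τ
    have hτc' := hcτ' τ
    have hinner : f' τ = 2 * ∫ p, (deriv (fun r => φ r p) τ * Real.exp (φ τ p / 2))
        * (Real.exp (φ 0 p / 2) - f τ * Real.exp (φ τ p / 2)) ∂μ := by
      have hpt : ∀ p, (deriv (fun r => φ r p) τ * Real.exp (φ τ p / 2))
          * (Real.exp (φ 0 p / 2) - f τ * Real.exp (φ τ p / 2))
          = 2 * (Real.exp ((φ 0 p + φ τ p) / 2) * (deriv (fun r => φ r p) τ / 2))
            - f τ * (Real.exp (φ τ p) * deriv (fun r => φ r p) τ) := fun p => by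
        rw [hexp_add, ← hexp_sq τ]; ring
      simp_rw [hpt]
      rw [integral_sub (hint (by fun_prop)) (hint (by fun_prop)),
        integral_const_mul, integral_const_mul, htangent τ hτ]
      simp only [hf'def]
      ring
    have hcs := sq_integral_mul_le_of_continuous μ
      (f := fun p => deriv (fun r => φ r p) τ * Real.exp (φ τ p / 2))
      (g := fun p => Real.exp (φ 0 p / 2) - f τ * Real.exp (φ τ p / 2))
      (by fun_prop) (by fun_prop)
    rw [hperp τ (Set.Ioo_subset_Icc_self hτ)] at hcs
    simp_rw [mul_pow, hexp_sq] at hcs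
    rw [hLdef, ← Real.sqrt_mul (integral_nonneg fun p => by positivity)]
    refine Real.abs_le_sqrt ?_
    rw [hinner]
    linarith
  have hf0 : f 0 = 1 := by
    simp only [hfdef, add_self_div_two, hφC 0 (by simp)]
    norm_num
  have hangle := arccos_le_arccos_add_integral hL (fun τ => Real.sqrt_nonneg _) hf hf1 hf'
  rwa [hf0, arccos_one, zero_add] at hangle
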